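/- Let H be an r-uniform hypergraph and let L be a list assignment giving each edge e a finite set L(e) of colors, such that (H, L) has maximum edge-color degree Δ. If |L(e)| ≥ rΔ + 1 for every edge e, then the reconfiguration graph RG_ELC(H, L) of proper L-edge-colorings is connected. -/

import Mathlib

/-- `c` is a proper `L`-edge-coloring of the hypergraph with edge set `E`: each edge
gets a color from its list, and intersecting edges get distinct colors. -/
def ProperLEdgeColoring {V C : Type*} [DecidableEq V] (E : Finset (Finset V))
    (L : Finset V → Finset C) (c : {e : Finset V // e ∈ E} → C) : Prop :=
  (∀ e, c e ∈ L e.val) ∧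
    ∀ e f : {e : Finset V // e ∈ E}, e ≠ f → (e.val ∩ f.val).Nonempty → c e ≠ c f

/-- Adjacency in the reconfiguration graph `RG_ELC(H, L)`: two proper
`L`-edge-colorings are adjacent if they differ at exactly one edge. -/
def ELCAdj {V C : Type*} [DecidableEq V] (E : Finset (Finset V))
    (L : Finset V → Finset C) (c c' : {e : Finset V // e ∈ E} → C) : Prop :=
  ProperLEdgeColoring E L c ∧ ProperLEdgeColoring E L c' ∧
    ∃ e, c e ≠ c' e ∧ ∀ f, f ≠ e → c f = c' f

set_option linter.unusedSectionVars false

section aux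
open Finset

structure SgnData {W : Type*} (e : W → W → ℝ) : Prop where
  diag : ∀ v, e v v = 1
  anti : ∀ u v, u ≠ v → e u v = - e v u
  sq : ∀ u v, e u v * e u v = 1

variable {W : Type*} [DecidableEq W]

def sgn (e : W → W → ℝ) (v : W) (σ : Finset W) : ℝ := ∏ u ∈ σ, e u v

def cob (e : W → W → ℝ) (φ : Finset W → ℝ) (σ : Finset W) : ℝ :=
  ∑ v ∈ σ, sgn e v σ * φ (σ.erase v)

theorem sgn_sq {e : W → W → ℝ} (he : SgnData e) (v : W) (σ : Finset W) :
    sgn e v σ * sgn e v σ = 1 := by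
  unfold sgn
  rw [← Finset.prod_mul_distrib]
  exact Finset.prod_eq_one fun u _ => he.sq u v

theorem sgn_insert {e : W → W → ℝ} (v u : W) (σ : Finset W) (hu : u ∉ σ) :
    sgn e v (insert u σ) = e u v * sgn e v σ := by
  unfold sgn
  rw [Finset.prod_insert hu]

theorem sgn_erase {e : W → W → ℝ} (he : SgnData e) (v u : W) (σ : Finset W) (hu : u ∈ σ) :
    sgn e v (σ.erase u) = e u v * sgn e v σ := by
  conv_rhs => rw [← Finset.insert_erase hu]
  rw [sgn_insert _ _ _ (Finset.notMem_erase u σ), ← mul_assoc, he.sq, one_mul]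

theorem cob_cob {e : W → W → ℝ} (he : SgnData e) (φ : Finset W → ℝ) (σ : Finset W) :
    cob e (cob e φ) σ = 0 := by
  have h1 : cob e (cob e φ) σ = ∑ v ∈ σ, ∑ u ∈ σ,
      if u = v then 0 else e v u * (sgn e v σ * sgn e u σ) * φ ((σ.erase v).erase u) := by
    unfold cob
    refine Finset.sum_congr rfl fun v hv => ?_
    rw [Finset.mul_sum, ← Finset.sum_erase (s := σ) (a := v) (by simp)]
    refine Finset.sum_congr rfl fun u hu => ?_
    rw [if_neg (Finset.ne_of_mem_erase hu), sgn_erase he u v σ hv]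
    ring
  have h2 : cob e (cob e φ) σ = - cob e (cob e φ) σ := by
    conv_lhs => rw [h1, Finset.sum_comm]
    rw [h1, ← Finset.sum_neg_distrib]
    refine Finset.sum_congr rfl fun v hv => ?_
    rw [← Finset.sum_neg_distrib]
    refine Finset.sum_congr rfl fun u hu => ?_
    by_cases h : u = v
    · simp [h]
    · rw [if_neg h, if_neg (Ne.symm h), he.anti u v h, Finset.erase_right_comm]
      ring
  linarith

theorem cob_sub (e : W → W → ℝ) (φ ψ : Finset W → ℝ) (σ : Finset W) :
    cob e (fun ρ => φ ρ - ψ ρ) σ = cob e φ σ - cob e ψ σ := by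
  unfold cob
  rw [← Finset.sum_sub_distrib]
  exact Finset.sum_congr rfl fun v _ => by ring

theorem cob_lin (e : W → W → ℝ) (a b : ℝ) (φ ψ : Finset W → ℝ) (σ : Finset W) :
    cob e (fun ρ => a * φ ρ + b * ψ ρ) σ = a * cob e φ σ + b * cob e ψ σ := by
  unfold cob
  rw [Finset.mul_sum, Finset.mul_sum, ← Finset.sum_add_distrib]
  exact Finset.sum_congr rfl fun v _ => by ring

theorem cob_congr (e : W → W → ℝ) {φ ψ : Finset W → ℝ} {σ : Finset W}
    (h : ∀ v ∈ σ, φ (σ.erase v) = ψ (σ.erase v)) : cob e φ σ = cob e ψ σ := by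
  unfold cob
  exact Finset.sum_congr rfl fun v hv => by rw [h v hv]

/-- Independent sets inside `U`. -/
def IndIn (N : W → W → Prop) (U : Finset W) (σ : Finset W) : Prop :=
  σ ⊆ U ∧ ∀ u ∈ σ, ∀ v ∈ σ, u ≠ v → ¬ N u v

theorem IndIn.erase {N : W → W → Prop} {U σ : Finset W} (h : IndIn N U σ) (v : W) :
    IndIn N U (σ.erase v) :=
  ⟨(Finset.erase_subset _ _).trans h.1, fun u hu w hw =>
    h.2 u (Finset.mem_of_mem_erase hu) w (Finset.mem_of_mem_erase hw)⟩

def xvec (e : W → W → ℝ) (h : Finset W → ℝ) (τ : Finset W) (v : W) : ℝ :=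
  if v ∈ τ then 0 else sgn e v τ * h (insert v τ)

theorem xvec_erase_sq {e : W → W → ℝ} (he : SgnData e) (h : Finset W → ℝ) {ρ : Finset W} {u : W}
    (hu : u ∈ ρ) : xvec e h (ρ.erase u) u ^ 2 = h ρ ^ 2 := by
  unfold xvec
  rw [if_neg (Finset.notMem_erase u ρ), Finset.insert_erase hu, mul_pow, sq (sgn _ _ _),
    sgn_sq he, one_mul]

variable [Fintype W]

theorem double_count (g : W → Finset W → ℝ) :
    ∑ ρ : Finset W, ∑ u ∈ ρ, g u (ρ.erase u) =
      ∑ τ : Finset W, ∑ u : W, if u ∈ τ then 0 else g u τ := by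
  have h1 : ∀ u : W, (∑ ρ : Finset W, if u ∈ ρ then g u (ρ.erase u) else 0) =
      ∑ τ : Finset W, if u ∈ τ then 0 else g u τ := by
    intro u
    rw [← Finset.sum_filter]
    have : ∀ τ : Finset W, (if u ∈ τ then 0 else g u τ) = if u ∉ τ then g u τ else 0 := by
      intro τ; split_ifs <;> simp_all
    simp_rw [this]
    rw [← Finset.sum_filter]
    refine Finset.sum_bij' (fun ρ _ => ρ.erase u) (fun τ _ => insert u τ) ?_ ?_ ?_ ?_ ?_
    · intro a ha; simp
    · intro a ha; simp
    · intro a ha; exact Finset.insert_erase (by simpa using ha)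
    · intro a ha; exact Finset.erase_insert (by simpa using ha)
    · intro a ha; rfl
  rw [Finset.sum_comm (s := (univ : Finset (Finset W))) (t := (univ : Finset W))]
  rw [← Finset.sum_congr rfl fun u _ => h1 u]
  rw [Finset.sum_comm]
  refine Finset.sum_congr rfl fun ρ _ => ?_
  rw [← Finset.sum_filter]
  simp

open Classical in
theorem spectral {e : W → W → ℝ} (he : SgnData e) (N : W → W → Prop)
    (hrefl : ∀ u, N u u) (hsymm : ∀ u v, N u v → N v u) (lam : ℝ)
    (hQ : ∀ x : W → ℝ, (∑ u, ∑ v, if N u v then x u ^ 2 - x u * x v else 0) ≤ lam * ∑ u, x u ^ 2)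
    (U : Finset W) (m : ℕ) (hU : lam * m < U.card) (h : Finset W → ℝ)
    (hsupp : ∀ σ, h σ ≠ 0 → IndIn N U σ ∧ σ.card = m)
    (hclosed : ∀ σ, IndIn N U σ → cob e h σ = 0)
    (hco : ∀ τ, ∑ v, xvec e h τ v = 0) : ∀ σ, h σ = 0 := by
  set t : W → W → Finset W → ℝ := fun v u τ =>
    if N u v then xvec e h τ u ^ 2 else xvec e h τ u * xvec e h τ v with ht
  -- pointwise inequality
  have hx0 : ∀ τ v, v ∉ U → xvec e h τ v = 0 := by
    intro τ v hv
    unfold xvec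
    split_ifs with h1
    · rfl
    · by_contra h2
      exact hv ((hsupp _ (right_ne_zero_of_mul h2)).1.1 (mem_insert_self _ _))
  have key : ∀ ρ, ∀ v ∈ U, h ρ ^ 2 ≤ ∑ u ∈ ρ, t v u (ρ.erase u) := by
    intro ρ v hv
    by_cases hρ : h ρ = 0
    · rw [hρ, Finset.sum_eq_zero]
      · simp
      · intro u hu
        have : xvec e h (ρ.erase u) u = 0 := by
          simp [xvec, Finset.insert_erase hu, hρ]
        simp [ht, this]
    obtain ⟨hI, hcard⟩ := hsupp ρ hρ
    by_cases hex : ∃ w ∈ ρ, N w v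
    · obtain ⟨w, hw, hwv⟩ := hex
      have hnn : ∀ u ∈ ρ, 0 ≤ t v u (ρ.erase u) := by
        intro u hu
        simp only [ht]
        split_ifs with h1
        · positivity
        · -- x_v = 0
          have : xvec e h (ρ.erase u) v = 0 := by
            unfold xvec
            split_ifs with h2
            · rfl
            · by_contra h3
              have h4 := (hsupp _ (right_ne_zero_of_mul h3)).1
              have hwu : w ≠ u := by rintro rfl; exact h1 hwv
              have hw' : w ∈ ρ.erase u := mem_erase.2 ⟨hwu, hw⟩
              exact h4.2 w (mem_insert_of_mem hw') v (mem_insert_self _ _)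
                (by rintro rfl; exact h2 hw') hwv
          rw [this]; simp
      refine le_trans ?_ (Finset.single_le_sum hnn hw)
      simp only [ht, if_pos hwv]
      rw [xvec_erase_sq he h hw]
    · push Not at hex
      have hvρ : v ∉ ρ := fun hv' => hex v hv' (hrefl v)
      have hI' : IndIn N U (insert v ρ) := by
        refine ⟨Finset.insert_subset hv hI.1, ?_⟩
        intro a ha b hb hab
        rw [mem_insert] at ha hb
        rcases ha with rfl | ha <;> rcases hb with rfl | hb
        · exact absurd rfl hab
        · exact fun hn => hex b hb (hsymm _ _ hn)
        · exact hex a ha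
        · exact hI.2 a ha b hb hab
      have hc := hclosed _ hI'
      unfold cob at hc
      rw [Finset.sum_insert hvρ, Finset.erase_insert hvρ, sgn_insert _ _ _ hvρ, he.diag, one_mul] at hc
      have e1 : ∑ u ∈ ρ, t v u (ρ.erase u) =
          - (sgn e v ρ * h ρ) * ∑ u ∈ ρ, sgn e u (insert v ρ) * h ((insert v ρ).erase u) := by
        rw [Finset.mul_sum]
        refine Finset.sum_congr rfl fun u hu => ?_
        have huv : u ≠ v := by rintro rfl; exact hvρ hu
        simp only [ht, if_neg (hex u hu)]
        unfold xvec
        rw [if_neg (Finset.notMem_erase u ρ), if_neg (fun hh => hvρ (mem_of_mem_erase hh)),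
          Finset.insert_erase hu, sgn_erase he u u ρ hu, sgn_erase he v u ρ hu, he.diag,
          sgn_insert u v ρ hvρ, Finset.erase_insert_of_ne (Ne.symm huv), he.anti u v huv]
        ring
      rw [e1]
      have e2 : ∑ u ∈ ρ, sgn e u (insert v ρ) * h ((insert v ρ).erase u) = - (sgn e v ρ * h ρ) := by
        linarith
      rw [e2]
      have := sgn_sq he v ρ
      apply le_of_eq
      linear_combination (-(h ρ)^2) * this
  -- sum over v
  have key2 : ∀ ρ, (U.card : ℝ) * h ρ ^ 2 ≤ ∑ u ∈ ρ, ∑ v, t v u (ρ.erase u) := by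
    intro ρ
    calc (U.card : ℝ) * h ρ ^ 2 = ∑ v ∈ U, h ρ ^ 2 := by simp
      _ ≤ ∑ v ∈ U, ∑ u ∈ ρ, t v u (ρ.erase u) := Finset.sum_le_sum fun v hv => key ρ v hv
      _ ≤ ∑ v, ∑ u ∈ ρ, t v u (ρ.erase u) := by
        refine Finset.sum_le_sum_of_subset_of_nonneg (Finset.subset_univ _) ?_
        intro v _ hv
        refine Finset.sum_nonneg fun u _ => ?_
        simp only [ht, hx0 _ v hv, mul_zero]
        split_ifs <;> positivity
      _ = _ := Finset.sum_comm
  have key3 : (U.card : ℝ) * ∑ ρ, h ρ ^ 2 ≤ ∑ τ : Finset W, lam * ∑ u, xvec e h τ u ^ 2 := by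
    rw [Finset.mul_sum]
    refine (Finset.sum_le_sum fun ρ _ => key2 ρ).trans ?_
    rw [double_count (fun u τ => ∑ v, t v u τ)]
    refine Finset.sum_le_sum fun τ _ => ?_
    refine le_trans (le_of_eq ?_) (hQ (xvec e h τ))
    have e3 : (∑ u, ∑ v, xvec e h τ u * xvec e h τ v) = 0 := by
      rw [← Finset.sum_mul_sum, hco, zero_mul]
    have e4 : (∑ u, ∑ v, if N u v then xvec e h τ u ^ 2 - xvec e h τ u * xvec e h τ v else 0) =
        (∑ u, ∑ v, if N u v then xvec e h τ u ^ 2 - xvec e h τ u * xvec e h τ v else 0) +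
        ∑ u, ∑ v, xvec e h τ u * xvec e h τ v := by
      rw [e3, add_zero]
    rw [e4, ← Finset.sum_add_distrib]
    refine Finset.sum_congr rfl fun u _ => ?_
    rw [← Finset.sum_add_distrib]
    split_ifs with h1
    · have : xvec e h τ u = 0 := by simp [xvec, h1]
      simp [this]
    · refine Finset.sum_congr rfl fun v _ => ?_
      simp only [ht]
      split_ifs <;> ring
  have key4 : ∑ τ : Finset W, ∑ u, xvec e h τ u ^ 2 = m * ∑ ρ, h ρ ^ 2 := by
    have := double_count (fun u τ => xvec e h τ u ^ 2)
    have e5 : ∀ τ u, (if u ∈ τ then 0 else xvec e h τ u ^ 2) = xvec e h τ u ^ 2 := by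
      intro τ u
      split_ifs with h1
      · simp [xvec, h1]
      · rfl
    simp_rw [e5] at this
    rw [← this, Finset.mul_sum]
    refine Finset.sum_congr rfl fun ρ _ => ?_
    rw [Finset.sum_congr rfl fun u hu => xvec_erase_sq he h hu]
    by_cases hρ : h ρ = 0
    · simp [hρ]
    · simp [(hsupp ρ hρ).2]
  rw [← Finset.mul_sum, key4] at key3
  have hs : ∑ ρ, h ρ ^ 2 = 0 := by
    by_contra hne
    have hpos : 0 < ∑ ρ, h ρ ^ 2 :=
      lt_of_le_of_ne (Finset.sum_nonneg fun _ _ => sq_nonneg _) (Ne.symm hne)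
    nlinarith
  intro σ
  have := (Finset.sum_eq_zero_iff_of_nonneg (fun ρ _ => sq_nonneg (h ρ))).1 hs σ (mem_univ _)
  simpa using this

open Classical in
theorem exact_of_spectral {e : W → W → ℝ} (he : SgnData e) (N : W → W → Prop)
    (hrefl : ∀ u, N u u) (hsymm : ∀ u v, N u v → N v u) (lam : ℝ)
    (hQ : ∀ x : W → ℝ, (∑ u, ∑ v, if N u v then x u ^ 2 - x u * x v else 0) ≤ lam * ∑ u, x u ^ 2)
    (U : Finset W) (m : ℕ) (hU : lam * (m + 1 : ℕ) < U.card) (φ : Finset W → ℝ)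
    (hsupp : ∀ σ, IndIn N U σ → φ σ ≠ 0 → σ.card = m + 1)
    (hclosed : ∀ σ, IndIn N U σ → cob e φ σ = 0) :
    ∃ ψ : Finset W → ℝ, (∀ σ, ψ σ ≠ 0 → IndIn N U σ ∧ σ.card = m) ∧
      ∀ σ, IndIn N U σ → φ σ = cob e ψ σ := by
  let A : Finset W → Prop := fun σ => IndIn N U σ ∧ σ.card = m + 1
  let D : (Finset W → ℝ) →ₗ[ℝ] EuclideanSpace ℝ (Finset W) :=
    { toFun := fun ψ => WithLp.toLp 2 fun σ => if A σ then cob e ψ σ else 0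
      map_add' := by
        intro a b
        ext σ
        have := cob_lin e 1 1 a b σ
        simp only [one_mul] at this
        by_cases h : A σ
        · simp [h]; exact this
        · simp [h]
      map_smul' := by
        intro c a
        ext σ
        have := cob_lin e c 0 a a σ
        simp only [zero_mul, add_zero] at this
        by_cases h : A σ
        · simp [h]; exact this
        · simp [h] }
  have hD : ∀ ψ σ, D ψ σ = if A σ then cob e ψ σ else 0 := fun ψ σ => rfl
  let φ' : EuclideanSpace ℝ (Finset W) := WithLp.toLp 2 fun σ => if A σ then φ σ else 0
  have hφ' : ∀ σ, φ' σ = if A σ then φ σ else 0 := fun σ => rfl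
  obtain ⟨y, hy, z, hz, hyz⟩ := (LinearMap.range D).exists_add_mem_mem_orthogonal φ'
  obtain ⟨ψ, rfl⟩ := hy
  have hzv : ∀ σ, z σ = if A σ then φ σ - cob e ψ σ else 0 := by
    intro σ
    have : φ' σ = D ψ σ + z σ := by rw [hyz]; rfl
    rw [hφ', hD] at this
    split_ifs at this ⊢ <;> linarith
  have hz0 : ∀ σ, z σ = 0 := by
    refine spectral he N hrefl hsymm lam hQ U (m + 1) hU (fun σ => z σ) ?_ ?_ ?_
    · intro σ hσ
      by_contra hA
      exact hσ (by simp only [hzv]; exact if_neg hA)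
    · intro σ hσ
      by_cases hc : σ.card = m + 2
      · have : cob e (fun σ => z σ) σ = cob e (fun σ => φ σ - cob e ψ σ) σ := by
          refine cob_congr e fun v hv => ?_
          rw [hzv, if_pos ⟨hσ.erase v, by rw [card_erase_of_mem hv]; omega⟩]
        rw [this, cob_sub e φ (cob e ψ), hclosed σ hσ, cob_cob he, sub_zero]
      · refine Finset.sum_eq_zero fun v hv => ?_
        have := card_erase_add_one hv
        simp only [hzv]
        rw [if_neg (fun hA => by have := hA.2; omega), mul_zero]
    · intro τ
      have h1 := (Submodule.mem_orthogonal _ _).1 hz _ (LinearMap.mem_range_self D (Pi.single τ 1))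
      have h2 : inner ℝ (D (Pi.single τ 1)) z = ∑ σ, ∑ u ∈ σ,
          (if σ.erase u = τ then sgn e u (σ.erase u) * z (insert u (σ.erase u)) else 0) := by
        rw [PiLp.inner_apply]
        refine Finset.sum_congr rfl fun σ _ => ?_
        rw [hD]
        by_cases hA : A σ
        · rw [if_pos hA]
          simp only [cob, RCLike.inner_apply, conj_trivial]
          rw [Finset.mul_sum]
          refine Finset.sum_congr rfl fun u hu => ?_
          rw [sgn_erase he u u σ hu, he.diag, Finset.insert_erase hu, Pi.single_apply]
          split_ifs <;> ring
        · rw [if_neg hA, inner_zero_left, Finset.sum_eq_zero]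
          intro u hu
          rw [Finset.insert_erase hu, hzv, if_neg hA]
          simp
      rw [h2, double_count (fun u τ' => if τ' = τ then sgn e u τ' * z (insert u τ') else 0)] at h1
      rw [Finset.sum_eq_single τ] at h1
      · rw [← h1]
        refine Finset.sum_congr rfl fun u _ => ?_
        simp [xvec]
      · intro b _ hb
        simp [hb]
      · simp
  refine ⟨fun σ => if IndIn N U σ ∧ σ.card = m then ψ σ else 0, ?_, ?_⟩
  · intro σ hσ
    by_contra hh
    exact hσ (if_neg hh)
  · intro σ hσ
    by_cases hc : σ.card = m + 1
    · have h1 := hz0 σ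
      rw [hzv, if_pos ⟨hσ, hc⟩] at h1
      rw [sub_eq_zero.1 h1]
      refine cob_congr e fun v hv => ?_
      rw [if_pos ⟨hσ.erase v, by rw [card_erase_of_mem hv]; omega⟩]
    · have h1 : φ σ = 0 := by
        by_contra hh
        exact hc (hsupp σ hσ hh)
      rw [h1]
      symm
      refine Finset.sum_eq_zero fun v hv => ?_
      have := card_erase_add_one hv
      beta_reduce
      rw [if_neg (fun hA => by have := hA.2; omega), mul_zero]

/-- Vertices lying in the parts of `T`. -/
def partsIn {ι : Type*} [DecidableEq ι] (π : W → ι) (T : Finset ι) : Finset W :=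
  univ.filter fun w => π w ∈ T

def ExactAt {ι : Type*} [DecidableEq ι] (e : W → W → ℝ) (N : W → W → Prop) (π : W → ι)
    (R T : Finset ι) : Prop :=
  ∀ m, m + 1 = T.card → ∀ φ : Finset W → ℝ,
    (∀ σ, IndIn N (partsIn π T) σ → φ σ ≠ 0 → σ.card = m + 1 ∧ R ⊆ σ.image π) →
    (∀ σ, IndIn N (partsIn π T) σ → cob e φ σ = 0) →
    ∃ ψ : Finset W → ℝ,
      (∀ σ, ψ σ ≠ 0 → IndIn N (partsIn π T) σ ∧ σ.card = m ∧ R ⊆ σ.image π) ∧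
      ∀ σ, IndIn N (partsIn π T) σ → φ σ = cob e ψ σ

theorem indIn_mono {N : W → W → Prop} {U U' σ : Finset W} (h : U ⊆ U') (hσ : IndIn N U σ) :
    IndIn N U' σ := ⟨hσ.1.trans h, hσ.2⟩

theorem partsIn_mono {ι : Type*} [DecidableEq ι] (π : W → ι) {T T' : Finset ι} (h : T ⊆ T') :
    partsIn π T ⊆ partsIn π T' := by
  intro w hw
  simp only [partsIn, mem_filter, mem_univ, true_and] at hw ⊢
  exact h hw

theorem image_subset_of_indIn {ι : Type*} [DecidableEq ι] {N : W → W → Prop} {π : W → ι}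
    {T : Finset ι} {σ : Finset W} (h : IndIn N (partsIn π T) σ) : σ.image π ⊆ T := by
  intro i hi
  obtain ⟨w, hw, rfl⟩ := mem_image.1 hi
  have := h.1 hw
  simpa [partsIn] using this

theorem indIn_of_image {ι : Type*} [DecidableEq ι] {N : W → W → Prop} {π : W → ι}
    {T T' : Finset ι} {σ : Finset W} (h : IndIn N (partsIn π T) σ) (h' : σ.image π ⊆ T') :
    IndIn N (partsIn π T') σ := by
  refine ⟨fun w hw => ?_, h.2⟩
  simp only [partsIn, mem_filter, mem_univ, true_and]
  exact h' (mem_image_of_mem π hw)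

open Classical in
theorem exactAt_all {ι : Type*} [DecidableEq ι] {e : W → W → ℝ} (he : SgnData e)
    (N : W → W → Prop) (π : W → ι)
    (h0 : ∀ T : Finset ι, T.Nonempty → ExactAt e N π ∅ T) (R : Finset ι) :
    ∀ T, R ⊂ T → ExactAt e N π R T := by
  induction R using Finset.induction_on with
  | empty => intro T hT; exact h0 T (Finset.empty_ssubset.1 hT)
  | insert i R hi ih =>
    intro T hT m hm φ hφ hcl
    have hiT : i ∈ T := hT.1 (mem_insert_self _ _)
    have hRT : R ⊂ T := (Finset.ssubset_insert hi).trans hT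
    have hRT' : R ⊂ T.erase i := by
      refine ⟨fun j hj => mem_erase.2 ⟨by rintro rfl; exact hi hj, hRT.1 hj⟩, fun hsub => hT.2 ?_⟩
      intro j hj
      by_cases hji : j = i
      · simp [hji]
      · exact mem_insert_of_mem (hsub (mem_erase.2 ⟨hji, hj⟩))
    have hsubT : partsIn π (T.erase i) ⊆ partsIn π T := partsIn_mono π (erase_subset _ _)
    obtain ⟨ψ, hψ, hψφ⟩ := ih T hRT m hm φ
      (fun σ hσ hne => ⟨(hφ σ hσ hne).1, (subset_insert _ _).trans (hφ σ hσ hne).2⟩) hcl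
    have hcard : (T.erase i).card = m := by rw [card_erase_of_mem hiT]; omega
    obtain ⟨m', rfl⟩ : ∃ m', m = m' + 1 := by
      have : 0 < (T.erase i).card := lt_of_le_of_lt (Nat.zero_le _) (card_lt_card hRT')
      exact ⟨m - 1, by omega⟩
    obtain ⟨χ, hχ, hχψ⟩ := ih (T.erase i) hRT' m' hcard.symm ψ
      (fun σ _ hne => (hψ σ hne).2) (by
        intro σ hσ
        rw [← hψφ σ (indIn_mono hsubT hσ)]
        by_contra hne
        have h1 := (hφ σ (indIn_mono hsubT hσ) hne).2 (mem_insert_self _ _)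
        have h2 := image_subset_of_indIn hσ h1
        simp at h2)
    refine ⟨fun σ => if IndIn N (partsIn π T) σ then ψ σ - cob e χ σ else 0, ?_, ?_⟩
    · intro σ hne
      have hI : IndIn N (partsIn π T) σ := by
        by_contra hh
        exact hne (if_neg hh)
      simp only [if_pos hI] at hne
      have hiσ : i ∈ σ.image π := by
        by_contra hh
        have h3 : IndIn N (partsIn π (T.erase i)) σ := by
          refine indIn_of_image hI fun j hj => mem_erase.2 ⟨?_, image_subset_of_indIn hI hj⟩
          rintro rfl
          exact hh hj
        exact hne (sub_eq_zero.2 (hχψ σ h3))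
      suffices h4 : σ.card = m' + 1 ∧ R ⊆ σ.image π from
        ⟨hI, h4.1, Finset.insert_subset hiσ h4.2⟩
      by_cases hz : ψ σ = 0
      · rw [hz, zero_sub, neg_ne_zero] at hne
        obtain ⟨v, hv, hne'⟩ := Finset.exists_ne_zero_of_sum_ne_zero hne
        have h5 := hχ _ (right_ne_zero_of_mul hne')
        refine ⟨?_, h5.2.2.trans (image_subset_image (erase_subset _ _))⟩
        rw [← card_erase_add_one hv, h5.2.1]
      · exact (hψ σ hz).2
    · intro σ hσ
      rw [hψφ σ hσ]
      have : cob e (fun σ => if IndIn N (partsIn π T) σ then ψ σ - cob e χ σ else 0) σ =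
          cob e (fun σ => ψ σ - cob e χ σ) σ :=
        cob_congr e fun v _ => if_pos (hσ.erase v)
      rw [this, cob_sub e ψ (cob e χ), cob_cob he, sub_zero]

theorem one_dim {ι : Type*} [DecidableEq ι] {e : W → W → ℝ}
    (N : W → W → Prop) (π : W → ι)
    (hex : ∀ R T : Finset ι, R ⊂ T → ExactAt e N π R T) (T : Finset ι) :
    ∀ φ φ' : Finset W → ℝ,
    (∀ σ, IndIn N (partsIn π T) σ → φ σ ≠ 0 → σ.card = T.card ∧ T ⊆ σ.image π) →
    (∀ σ, IndIn N (partsIn π T) σ → φ' σ ≠ 0 → σ.card = T.card ∧ T ⊆ σ.image π) →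
    (∀ σ, IndIn N (partsIn π T) σ → cob e φ σ = 0) →
    (∀ σ, IndIn N (partsIn π T) σ → cob e φ' σ = 0) →
    ∃ a b : ℝ, (a ≠ 0 ∨ b ≠ 0) ∧ ∀ σ, IndIn N (partsIn π T) σ → a * φ σ + b * φ' σ = 0 := by
  induction T using Finset.induction_on with
  | empty =>
    intro φ φ' _ _ _ _
    have hs : ∀ σ, IndIn N (partsIn π ∅) σ → σ = ∅ := by
      intro σ hσ
      have := image_subset_of_indIn hσ
      simpa using this
    by_cases h : φ ∅ = 0
    · refine ⟨1, 0, Or.inl one_ne_zero, fun σ hσ => ?_⟩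
      rw [hs σ hσ, h]; ring
    · refine ⟨φ' ∅, - φ ∅, Or.inr (neg_ne_zero.2 h), fun σ hσ => ?_⟩
      rw [hs σ hσ]; ring
  | insert i T hi ih =>
    intro φ φ' hφ hφ' hc hc'
    have hsub : partsIn π T ⊆ partsIn π (insert i T) := partsIn_mono π (subset_insert _ _)
    have hcard : (insert i T).card = T.card + 1 := card_insert_of_notMem hi
    have hE := hex T (insert i T) (Finset.ssubset_insert hi) T.card hcard.symm
    have aux : ∀ φ : Finset W → ℝ, (∀ σ, IndIn N (partsIn π (insert i T)) σ → φ σ ≠ 0 →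
        σ.card = (insert i T).card ∧ insert i T ⊆ σ.image π) →
        ∀ σ, IndIn N (partsIn π T) σ → φ σ = 0 := by
      intro φ hφ σ hσ
      by_contra hne
      exact hi (image_subset_of_indIn hσ ((hφ σ (indIn_mono hsub hσ) hne).2 (mem_insert_self _ _)))
    obtain ⟨ψ, hψ, h1⟩ := hE φ (fun σ hσ hne => ⟨hcard ▸ (hφ σ hσ hne).1,
      (subset_insert _ _).trans (hφ σ hσ hne).2⟩) hc
    obtain ⟨ψ', hψ', h1'⟩ := hE φ' (fun σ hσ hne => ⟨hcard ▸ (hφ' σ hσ hne).1,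
      (subset_insert _ _).trans (hφ' σ hσ hne).2⟩) hc'
    obtain ⟨a, b, hab, h2⟩ := ih ψ ψ' (fun σ _ hne => (hψ σ hne).2) (fun σ _ hne => (hψ' σ hne).2)
      (fun σ hσ => by rw [← h1 σ (indIn_mono hsub hσ), aux φ hφ σ hσ])
      (fun σ hσ => by rw [← h1' σ (indIn_mono hsub hσ), aux φ' hφ' σ hσ])
    have big : ∀ ρ, IndIn N (partsIn π (insert i T)) ρ → ρ.card = T.card ∧ T ⊆ ρ.image π →
        IndIn N (partsIn π T) ρ := by
      intro ρ hρ h3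
      refine indIn_of_image hρ ?_
      exact (Finset.eq_of_subset_of_card_le h3.2 (card_image_le.trans h3.1.le)).ge
    refine ⟨a, b, hab, fun σ hσ => ?_⟩
    rw [h1 σ hσ, h1' σ hσ, ← cob_lin]
    refine Finset.sum_eq_zero fun v hv => ?_
    have hz : a * ψ (σ.erase v) + b * ψ' (σ.erase v) = 0 := by
      by_cases hA : ψ (σ.erase v) = 0
      · by_cases hB : ψ' (σ.erase v) = 0
        · rw [hA, hB]; ring
        · exact h2 _ (big _ (hσ.erase v) (hψ' _ hB).2)
      · exact h2 _ (big _ (hσ.erase v) (hψ _ hA).2)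
    simp only [hz, mul_zero]

theorem quad_bound {Q : Type*} (s : Finset Q) (N : W → W → Prop) [∀ u v, Decidable (N u v)]
    (hsymm : ∀ u v, N u v → N v u)
    (B : W → Q → ℝ) (hB : ∀ u q, 0 ≤ B u q)
    (hN : ∀ u v, N u v → u ≠ v → 1 ≤ ∑ q ∈ s, B u q * B v q) (lam : ℝ)
    (hrow : ∀ u, ∑ v, ∑ q ∈ s, B u q * B v q ≤ lam) (x : W → ℝ) :
    (∑ u, ∑ v, if N u v then x u ^ 2 - x u * x v else 0) ≤ lam * ∑ u, x u ^ 2 := by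
  set M : W → W → ℝ := fun u v => ∑ q ∈ s, B u q * B v q with hM
  have hMs : ∀ u v, M u v = M v u := fun u v => Finset.sum_congr rfl fun q _ => mul_comm _ _
  have h1 : (∑ u, ∑ v, if N u v then x u ^ 2 - x u * x v else 0) =
      ∑ u, ∑ v, if N u v then x v ^ 2 - x u * x v else 0 := by
    rw [Finset.sum_comm]
    refine Finset.sum_congr rfl fun u _ => Finset.sum_congr rfl fun v _ => ?_
    by_cases h : N u v
    · rw [if_pos h, if_pos (hsymm _ _ h)]; ring
    · rw [if_neg h, if_neg (fun h' => h (hsymm _ _ h'))]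
  have h2 : (∑ u, ∑ v, M u v * (x u ^ 2 - x u * x v)) =
      ∑ u, ∑ v, M u v * (x v ^ 2 - x u * x v) := by
    rw [Finset.sum_comm]
    refine Finset.sum_congr rfl fun u _ => Finset.sum_congr rfl fun v _ => ?_
    rw [hMs]; ring
  have h3 : (∑ u, ∑ v, if N u v then x u ^ 2 - x u * x v else 0) +
      (∑ u, ∑ v, if N u v then x v ^ 2 - x u * x v else 0) ≤
      (∑ u, ∑ v, M u v * (x u ^ 2 - x u * x v)) + ∑ u, ∑ v, M u v * (x v ^ 2 - x u * x v) := by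
    simp only [← Finset.sum_add_distrib]
    refine Finset.sum_le_sum fun u _ => Finset.sum_le_sum fun v _ => ?_
    have hM0 : 0 ≤ M u v := Finset.sum_nonneg fun q _ => mul_nonneg (hB _ _) (hB _ _)
    by_cases huv : u = v
    · subst huv
      split_ifs <;> nlinarith
    · have hsq : 0 ≤ (x u - x v) ^ 2 := sq_nonneg _
      split_ifs with h
      · have := hN u v h huv
        have h6 : 0 ≤ (M u v - 1) * (x u - x v) ^ 2 := mul_nonneg (sub_nonneg.2 this) hsq
        nlinarith
      · have h6 : 0 ≤ M u v * (x u - x v) ^ 2 := mul_nonneg hM0 hsq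
        nlinarith
  have h4 : (∑ u, ∑ v, M u v * (x u ^ 2 - x u * x v)) ≤ lam * ∑ u, x u ^ 2 := by
    have e1 : (∑ u, ∑ v, M u v * (x u ^ 2 - x u * x v)) =
        (∑ u, (∑ v, M u v) * x u ^ 2) - ∑ u, ∑ v, M u v * (x u * x v) := by
      rw [← Finset.sum_sub_distrib]
      refine Finset.sum_congr rfl fun u _ => ?_
      rw [Finset.sum_mul, ← Finset.sum_sub_distrib]
      exact Finset.sum_congr rfl fun v _ => by ring
    have e2 : (∑ u, ∑ v, M u v * (x u * x v)) = ∑ q ∈ s, (∑ u, B u q * x u) ^ 2 := by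
      simp only [hM, Finset.sum_mul]
      simp only [sq, Finset.sum_mul_sum]
      rw [Finset.sum_comm (s := s)]
      refine Finset.sum_congr rfl fun u _ => ?_
      rw [Finset.sum_comm (s := s)]
      exact Finset.sum_congr rfl fun v _ => Finset.sum_congr rfl fun q _ => by ring
    have e3 : 0 ≤ ∑ q ∈ s, (∑ u, B u q * x u) ^ 2 := Finset.sum_nonneg fun _ _ => sq_nonneg _
    have e4 : (∑ u, (∑ v, M u v) * x u ^ 2) ≤ lam * ∑ u, x u ^ 2 := by
      rw [Finset.mul_sum]
      exact Finset.sum_le_sum fun u _ => mul_le_mul_of_nonneg_right (hrow u) (sq_nonneg _)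
    rw [e1, e2]; linarith
  linarith

end aux

section transversal
open Finset

variable {ι : Type*} [Fintype ι] [DecidableEq ι] {K : ι → Type*} [∀ i, Fintype (K i)]
  [∀ i, DecidableEq (K i)]

def gr (a : ∀ i, K i) : Finset (Σ i, K i) := univ.image fun i => ⟨i, a i⟩

theorem mem_gr (a : ∀ i, K i) (w : Σ i, K i) : w ∈ gr a ↔ a w.1 = w.2 := by
  obtain ⟨i, k⟩ := w
  simp only [gr, mem_image, mem_univ, true_and]
  constructor
  · rintro ⟨j, hj⟩
    cases hj
    rfl
  · intro h
    exact ⟨i, by rw [← show a i = k from h]⟩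

theorem gr_inj {a b : ∀ i, K i} (h : gr a = gr b) : a = b := by
  funext i
  have : (⟨i, a i⟩ : Σ i, K i) ∈ gr b := by rw [← h, mem_gr]
  rw [mem_gr] at this
  exact this.symm

theorem card_gr (a : ∀ i, K i) : (gr a).card = Fintype.card ι := by
  rw [gr, card_image_of_injective]
  · rfl
  · intro i j h
    exact congrArg Sigma.fst h

open Classical in
noncomputable def esg (K : ι → Type*) (u v : Σ i, K i) : ℝ :=
  if u = v then 1 else
  if u.1 = v.1 then (if WellOrderingRel u v then -1 else 1)
  else (if WellOrderingRel u.1 v.1 then -1 else 1)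

theorem esg_aux {α : Type*} [DecidableRel (WellOrderingRel (α := α))] (u v : α) (h : u ≠ v) :
    (if WellOrderingRel u v then (-1 : ℝ) else 1) = - (if WellOrderingRel v u then (-1 : ℝ) else 1) := by
  rcases trichotomous_of WellOrderingRel u v with h1 | h1 | h1
  · rw [if_pos h1, if_neg (asymm h1)]
  · exact absurd h1 h
  · rw [if_pos h1, if_neg (asymm h1)]; simp

theorem esg_data (K : ι → Type*) : SgnData (esg K) where
  diag v := by simp [esg]
  anti u v h := by
    classical
    unfold esg
    rw [if_neg h, if_neg (Ne.symm h)]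
    by_cases h1 : u.1 = v.1
    · rw [if_pos h1, if_pos h1.symm]
      exact esg_aux u v h
    · rw [if_neg h1, if_neg (Ne.symm h1)]
      exact esg_aux u.1 v.1 h1
  sq u v := by
    unfold esg
    split_ifs <;> norm_num

theorem esg_same (w u v : Σ i, K i) (h : u.1 = v.1) (hw : w.1 ≠ u.1) : esg K w u = esg K w v := by
  have hw' : w.1 ≠ v.1 := h ▸ hw
  have h1 : w ≠ u := fun hh => hw (hh ▸ rfl)
  have h2 : w ≠ v := fun hh => hw' (hh ▸ rfl)
  unfold esg
  rw [if_neg h1, if_neg h2, if_neg hw, if_neg hw', h]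

open Classical in
noncomputable def gP (N : (Σ i, K i) → (Σ i, K i) → Prop) (P : (∀ i, K i) → Prop)
    (σ : Finset (Σ i, K i)) : ℝ :=
  if ∃ a, IndIn N univ (gr a) ∧ P a ∧ σ = gr a then 1 else 0

theorem gP_closed (N : (Σ i, K i) → (Σ i, K i) → Prop) (P : (∀ i, K i) → Prop)
    (hP : ∀ a i k, IndIn N univ (gr a) → IndIn N univ (gr (Function.update a i k)) → P a →
      P (Function.update a i k)) (σ : Finset (Σ i, K i)) (hσ : IndIn N univ σ) :
    cob (esg K) (gP N P) σ = 0 := by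
  by_cases hex : ∃ v ∈ σ, ∃ a, σ.erase v = gr a
  swap
  · refine Finset.sum_eq_zero fun v hv => ?_
    rw [gP, if_neg, mul_zero]
    rintro ⟨a, _, _, ha⟩
    exact hex ⟨v, hv, a, ha⟩
  obtain ⟨v, hv, a, ha⟩ := hex
  obtain ⟨i, k⟩ := v
  have hva : a i ≠ k := by
    intro h
    have : (⟨i, k⟩ : Σ i, K i) ∈ gr a := (mem_gr _ _).2 h
    rw [← ha] at this
    simp at this
  have hu : (⟨i, a i⟩ : Σ i, K i) ∈ σ := by
    have : (⟨i, a i⟩ : Σ i, K i) ∈ gr a := (mem_gr _ _).2 rfl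
    rw [← ha] at this
    exact mem_of_mem_erase this
  have huv : (⟨i, a i⟩ : Σ i, K i) ≠ ⟨i, k⟩ := by
    intro h
    apply hva
    simpa using h
  have hmem : ∀ w, w ∈ σ ↔ w = ⟨i, k⟩ ∨ a w.1 = w.2 := by
    intro w
    rw [← mem_gr, ← ha, mem_erase]
    by_cases h : w = ⟨i, k⟩
    · simp [h, hv]
    · simp [h]
  have hb : σ.erase ⟨i, a i⟩ = gr (Function.update a i k) := by
    ext ⟨j, l⟩
    rw [mem_erase, mem_gr, hmem]
    by_cases hj : j = i
    · subst hj
      simp only [Function.update_self, ne_eq, Sigma.mk.injEq, heq_eq_eq, true_and]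
      constructor
      · rintro ⟨h1, h2 | h2⟩
        · exact h2.symm
        · exact absurd h2.symm h1
      · rintro rfl
        exact ⟨fun h => hva h.symm, Or.inl rfl⟩
    · simp [hj]
  have hIa : IndIn N univ (gr a) := ha ▸ hσ.erase _
  have hIb : IndIn N univ (gr (Function.update a i k)) := hb ▸ hσ.erase _
  have hPab : P a ↔ P (Function.update a i k) := by
    refine ⟨hP a i k hIa hIb, fun h => ?_⟩
    have := hP (Function.update a i k) i (a i) hIb (by simpa using hIa) h
    simpa using this
  have hgab : gP N P (gr a) = gP N P (gr (Function.update a i k)) := by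
    unfold gP
    congr 1
    apply propext
    constructor
    · rintro ⟨c, _, h2, h3⟩
      obtain rfl := gr_inj h3
      exact ⟨_, hIb, hPab.1 h2, rfl⟩
    · rintro ⟨c, _, h2, h3⟩
      obtain rfl := gr_inj h3
      exact ⟨_, hIa, hPab.2 h2, rfl⟩
  unfold cob
  rw [Finset.sum_eq_add_of_mem _ _ hu hv huv]
  · rw [ha, hb, hgab, ← add_mul]
    have he := esg_data K
    have s1 : sgn (esg K) ⟨i, a i⟩ σ = esg K ⟨i, k⟩ ⟨i, a i⟩ *
        sgn (esg K) ⟨i, a i⟩ ((σ.erase ⟨i, k⟩).erase ⟨i, a i⟩) := by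
      rw [sgn_erase he _ _ _ (mem_erase.2 ⟨huv, hu⟩), he.diag, one_mul, sgn_erase he _ _ _ hv,
        ← mul_assoc, he.sq, one_mul]
    have s2 : sgn (esg K) ⟨i, k⟩ σ = esg K ⟨i, a i⟩ ⟨i, k⟩ *
        sgn (esg K) ⟨i, k⟩ ((σ.erase ⟨i, k⟩).erase ⟨i, a i⟩) := by
      rw [sgn_erase he _ _ _ (mem_erase.2 ⟨huv, hu⟩), sgn_erase he _ _ _ hv, he.diag, one_mul,
        ← mul_assoc, he.sq, one_mul]
    have s3 : sgn (esg K) ⟨i, a i⟩ ((σ.erase ⟨i, k⟩).erase ⟨i, a i⟩) =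
        sgn (esg K) ⟨i, k⟩ ((σ.erase ⟨i, k⟩).erase ⟨i, a i⟩) := by
      refine Finset.prod_congr rfl fun w hw => esg_same w _ _ rfl ?_
      rw [ha, mem_erase, mem_gr] at hw
      obtain ⟨j, l⟩ := w
      rintro hji
      dsimp only at hji
      subst hji
      have h2 : a j = l := hw.2
      exact hw.1 (by rw [h2])
    rw [s1, s2, s3, he.anti _ _ huv]
    ring
  · intro w hw hne
    rw [gP, if_neg, mul_zero]
    rintro ⟨c, _, _, hc⟩
    have c1 : (⟨i, a i⟩ : Σ i, K i) ∈ gr c := hc ▸ mem_erase.2 ⟨hne.1.symm, hu⟩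
    have c2 : (⟨i, k⟩ : Σ i, K i) ∈ gr c := hc ▸ mem_erase.2 ⟨hne.2.symm, hv⟩
    rw [mem_gr] at c1 c2
    exact hva (c1.symm.trans c2)

open Classical in
theorem transversal_conn (N : (Σ i, K i) → (Σ i, K i) → Prop)
    (hrefl : ∀ u, N u u) (hsymm : ∀ u v, N u v → N v u) (lam : ℝ)
    (hQ : ∀ x : (Σ i, K i) → ℝ,
      (∑ u, ∑ v, if N u v then x u ^ 2 - x u * x v else 0) ≤ lam * ∑ u, x u ^ 2)
    (hK : ∀ i, lam < Fintype.card (K i))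
    (P : (∀ i, K i) → Prop)
    (hP : ∀ a i k, IndIn N univ (gr a) → IndIn N univ (gr (Function.update a i k)) → P a →
      P (Function.update a i k))
    (c c' : ∀ i, K i) (hc : IndIn N univ (gr c)) (hc' : IndIn N univ (gr c')) (hPc : P c) :
    P c' := by
  have he := esg_data K
  have h0 : ∀ T : Finset ι, T.Nonempty → ExactAt (esg K) N Sigma.fst ∅ T := by
    intro T hT m hm φ h1 h2
    have hcard : ((partsIn (Sigma.fst : (Σ i, K i) → ι) T).card : ℝ) =
        ∑ i ∈ T, (Fintype.card (K i) : ℝ) := by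
      have : partsIn (Sigma.fst : (Σ i, K i) → ι) T = T.sigma fun i => univ := by
        ext w; simp [partsIn]
      rw [this, card_sigma]
      push_cast
      rfl
    obtain ⟨ψ, h3, h4⟩ := exact_of_spectral he N hrefl hsymm lam hQ (partsIn Sigma.fst T) m (by
      rw [hcard, hm]
      calc lam * (T.card : ℝ) = ∑ i ∈ T, lam := by simp [mul_comm]
        _ < _ := Finset.sum_lt_sum_of_nonempty hT fun i _ => hK i) φ
      (fun σ hσ hne => (h1 σ hσ hne).1) h2
    exact ⟨ψ, fun σ hne => ⟨(h3 σ hne).1, (h3 σ hne).2, by simp⟩, h4⟩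
  have hU : partsIn (Sigma.fst : (Σ i, K i) → ι) univ = univ := by ext; simp [partsIn]
  have hsup : ∀ (P : (∀ i, K i) → Prop) σ, IndIn N (partsIn Sigma.fst univ) σ → gP N P σ ≠ 0 →
      σ.card = (univ : Finset ι).card ∧ univ ⊆ σ.image Sigma.fst := by
    intro P σ _ hne
    have : ∃ a, IndIn N univ (gr a) ∧ P a ∧ σ = gr a := by
      by_contra hh
      exact hne (if_neg hh)
    obtain ⟨a, _, _, rfl⟩ := this
    refine ⟨card_gr a, fun i _ => mem_image.2 ⟨⟨i, a i⟩, (mem_gr _ _).2 rfl, rfl⟩⟩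
  obtain ⟨s, t, hst, h⟩ := one_dim N Sigma.fst (exactAt_all he N Sigma.fst h0) univ
    (gP N P) (gP N fun _ => True) (hsup _) (hsup _)
    (fun σ hσ => gP_closed N P hP σ (hU ▸ hσ))
    (fun σ hσ => gP_closed N _ (fun _ _ _ _ _ _ => trivial) σ (hU ▸ hσ))
  rw [hU] at h
  by_contra hPc'
  have k1 := h _ hc
  have k2 := h _ hc'
  have g1 : gP N P (gr c) = 1 := if_pos ⟨c, hc, hPc, rfl⟩
  have g2 : gP N (fun _ => True) (gr c) = 1 := if_pos ⟨c, hc, trivial, rfl⟩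
  have g3 : gP N P (gr c') = 0 := by
    refine if_neg ?_
    rintro ⟨b, _, hb, hbc⟩
    exact hPc' (gr_inj hbc ▸ hb)
  have g4 : gP N (fun _ => True) (gr c') = 1 := if_pos ⟨c', hc', trivial, rfl⟩
  rw [g1, g2] at k1
  rw [g3, g4] at k2
  rcases hst with hs | hs
  · apply hs; linarith
  · apply hs; linarith

end transversal

/-- If `H` is an `r`-uniform hypergraph, `(H, L)` has maximum edge-color degree `Δ`
(for every color `k` and vertex `v`, at most `Δ` edges containing `v` have `k` in
their list) and `|L(e)| ≥ rΔ + 1` for every edge, then the reconfiguration graph on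
proper `L`-edge-colorings is connected. -/
theorem stmt_18 {V C : Type*} [Fintype V] [DecidableEq V] [DecidableEq C]
    (E : Finset (Finset V)) (r Δ : ℕ)
    (huniform : ∀ e ∈ E, e.card = r)
    (L : Finset V → Finset C)
    (hΔ : ∀ (col : C) (v : V),
      (E.filter fun e => v ∈ e ∧ col ∈ L e).card ≤ Δ)
    (hL : ∀ e ∈ E, r * Δ + 1 ≤ (L e).card)
    (c c' : {e : Finset V // e ∈ E} → C)
    (hc : ProperLEdgeColoring E L c) (hc' : ProperLEdgeColoring E L c') :
    Relation.ReflTransGen (ELCAdj E L) c c' := by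
  classical
  set K : {e : Finset V // e ∈ E} → Type _ := fun e => {k : C // k ∈ L e.val} with hKdef
  let N : (Σ e, K e) → (Σ e, K e) → Prop := fun u v =>
    u.2.1 = v.2.1 ∧ (u.1 = v.1 ∨ (u.1.1 ∩ v.1.1).Nonempty)
  have ext' : ∀ u v : Σ e, K e, u.1 = v.1 → u.2.1 = v.2.1 → u = v := by
    rintro ⟨e, k, hk⟩ ⟨f, l, hl⟩ h1 h2
    dsimp only at h1 h2
    subst h1
    subst h2
    rfl
  have hrefl : ∀ u, N u u := fun u => ⟨rfl, Or.inl rfl⟩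
  have hsymm : ∀ u v, N u v → N v u := by
    rintro u v ⟨h1, h2⟩
    refine ⟨h1.symm, h2.imp Eq.symm ?_⟩
    rw [Finset.inter_comm]
    exact id
  let B : (Σ e, K e) → V × C → ℝ := fun u q => if q.1 ∈ u.1.1 ∧ u.2.1 = q.2 then 1 else 0
  let s : Finset (V × C) := Finset.univ ×ˢ (Finset.univ.image fun u : Σ e, K e => u.2.1)
  have hB0 : ∀ u q, 0 ≤ B u q := by
    intro u q
    simp only [B]
    split_ifs <;> norm_num
  have hcol : ∀ q, ∑ v, B v q ≤ (Δ : ℝ) := by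
    intro q
    simp only [B]
    rw [Finset.sum_boole]
    refine le_trans ?_ (Nat.cast_le.2 (hΔ q.2 q.1))
    refine Nat.cast_le.2 (Finset.card_le_card_of_injOn (fun u => u.1.1) ?_ ?_)
    · intro u hu
      have hu' : q.1 ∈ u.1.1 ∧ u.2.1 = q.2 := by simpa using hu
      simp only [Finset.coe_filter, Set.mem_ofPred_eq]
      exact ⟨u.1.2, hu'.1, hu'.2 ▸ u.2.2⟩
    · intro u hu v hv huv
      have hu' : q.1 ∈ u.1.1 ∧ u.2.1 = q.2 := by simpa using hu
      have hv' : q.1 ∈ v.1.1 ∧ v.2.1 = q.2 := by simpa using hv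
      exact ext' u v (Subtype.ext huv) (hu'.2.trans hv'.2.symm)
  have hsum : ∀ u, ∑ q ∈ s, B u q = (r : ℝ) := by
    intro u
    simp only [B]
    rw [Finset.sum_boole, ← huniform u.1.1 u.1.2]
    have : (s.filter fun q => q.1 ∈ u.1.1 ∧ u.2.1 = q.2) = u.1.1.image fun p => (p, u.2.1) := by
      ext ⟨p, k⟩
      simp only [s, Finset.mem_filter, Finset.mem_product, Finset.mem_univ, true_and,
        Finset.mem_image, Prod.mk.injEq]
      constructor
      · rintro ⟨_, h1, h2⟩
        exact ⟨p, h1, rfl, h2⟩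
      · rintro ⟨p', h1, rfl, h2⟩
        exact ⟨⟨u, h2⟩, h1, h2⟩
    rw [this, Finset.card_image_of_injective]
    intro a b hab
    exact congrArg Prod.fst hab
  have hQ := quad_bound s N hsymm B hB0 (by
    rintro u v ⟨h1, h2⟩ huv
    rcases h2 with h2 | ⟨p, hp⟩
    · exact absurd (ext' u v h2 h1) huv
    · rw [Finset.mem_inter] at hp
      have hmem : (p, u.2.1) ∈ s := by
        simp only [s, Finset.mem_product, Finset.mem_univ, true_and, Finset.mem_image]
        exact ⟨u, rfl⟩
      refine le_trans (le_of_eq ?_)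
        (Finset.single_le_sum (fun q _ => mul_nonneg (hB0 u q) (hB0 v q)) hmem)
      simp [B, hp.1, hp.2, h1]) ((r : ℝ) * Δ) (by
    intro u
    rw [Finset.sum_comm, ← hsum u, Finset.sum_mul]
    refine Finset.sum_le_sum fun q _ => ?_
    rw [← Finset.mul_sum]
    exact mul_le_mul_of_nonneg_left (hcol q) (hB0 u q))
  have hK : ∀ e, (r : ℝ) * Δ < Fintype.card (K e) := by
    intro e
    have h1 : Fintype.card (K e) = (L e.val).card := Fintype.card_coe _
    have h2 := hL e.val e.2
    rw [h1]
    exact_mod_cast h2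
  have hproper : ∀ a : ∀ e, K e, IndIn N Finset.univ (gr a) ↔
      ProperLEdgeColoring E L fun e => (a e).1 := by
    intro a
    constructor
    · intro h
      refine ⟨fun e => (a e).2, fun e f hef hne heq => ?_⟩
      refine h.2 ⟨e, a e⟩ ((mem_gr _ _).2 rfl) ⟨f, a f⟩ ((mem_gr _ _).2 rfl) ?_ ⟨heq, Or.inr hne⟩
      intro hh
      exact hef (congrArg Sigma.fst hh)
    · intro h
      refine ⟨Finset.subset_univ _, fun u hu v hv huv hN => ?_⟩
      rw [mem_gr] at hu hv
      have h1 : u.1 ≠ v.1 := fun h1 => huv (ext' u v h1 hN.1)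
      refine h.2 u.1 v.1 h1 (hN.2.resolve_left h1) ?_
      have := hN.1
      rw [← hu, ← hv] at this
      exact this
  let a : ∀ e, K e := fun e => ⟨c e, hc.1 e⟩
  let a' : ∀ e, K e := fun e => ⟨c' e, hc'.1 e⟩
  refine transversal_conn N hrefl hsymm _ (fun x => ?_) hK
    (fun b => Relation.ReflTransGen (ELCAdj E L) c fun e => (b e).1) ?_ a a'
    ((hproper a).2 hc) ((hproper a').2 hc') Relation.ReflTransGen.refl
  · convert hQ x
  · intro b i k h1 h2 h3
    by_cases hk : k = b i
    · subst hk
      simpa using h3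
    · refine h3.tail ⟨(hproper _).1 h1, (hproper _).1 h2, i, ?_, ?_⟩
      · simp only [Function.update_self]
        exact fun h => hk (Subtype.ext h.symm)
      · intro f hf
        simp only [Function.update_of_ne hf]
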